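/- Fix an integer ℓ > 2. Every (ℓ,0)-JM partition is a node of the ladder crystal B(Λ0)^L. -/

import Mathlib

noncomputable section

/-!
Common combinatorial definitions: partitions (English notation, rows indexed from 1),
Young diagrams, hooks, rim hooks, ladders, residues, crystal operators (classical and
ladder versions), locked boxes, regularization classes, dominance order.
-/

structure YPartition where
  part : ℕ → ℕ
  zero_at_zero : part 0 = 0
  antitone : ∀ i j : ℕ, 1 ≤ i → i ≤ j → part j ≤ part i
  eventually_zero : ∃ N : ℕ, ∀ i : ℕ, N ≤ i → part i = 0

namespace YPartition

/-- The set of boxes of the Young diagram of `μ` (row, column), both indices ≥ 1. -/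
def cells (μ : YPartition) : Set (ℕ × ℕ) :=
  {p | 1 ≤ p.1 ∧ 1 ≤ p.2 ∧ p.2 ≤ μ.part p.1}

/-- The length of column `b`: the number of rows containing a box in column `b`. -/
def colLen (μ : YPartition) (b : ℕ) : ℕ :=
  Nat.card {a : ℕ | 1 ≤ a ∧ b ≤ μ.part a}

/-- The arm of box `(a,b)`: boxes strictly to its right in its row. -/
def arm (μ : YPartition) (a b : ℕ) : ℕ := μ.part a - b

/-- The leg of box `(a,b)`: boxes strictly below it in its column. -/
def leg (μ : YPartition) (a b : ℕ) : ℕ := μ.colLen b - a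

/-- The hook length of the box `(a,b)`: arm + leg + 1. -/
def hook (μ : YPartition) (a b : ℕ) : ℕ := (μ.part a - b) + (μ.colLen b - a) + 1

/-- The number of boxes of `μ`. -/
def size (μ : YPartition) : ℕ := μ.cells.ncard

/-- The number of (nonzero) parts of `μ`. -/
def length (μ : YPartition) : ℕ := μ.colLen 1

/-- `μ` is an `(ℓ,0)`-JM partition: there are no boxes `(a,b)`, `(a,y)`, `(x,b)` with
`ℓ ∣ hook (a,b)` while `ℓ` divides neither `hook (a,y)` nor `hook (x,b)`. -/
def IsJM (ℓ : ℕ) (μ : YPartition) : Prop :=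
  ¬ ∃ a b y x : ℕ, (a, b) ∈ μ.cells ∧ (a, y) ∈ μ.cells ∧ (x, b) ∈ μ.cells ∧
    ℓ ∣ μ.hook a b ∧ ¬ ℓ ∣ μ.hook a y ∧ ¬ ℓ ∣ μ.hook x b

/-- Two boxes share an edge. -/
def BoxAdjacent (p q : ℕ × ℕ) : Prop :=
  (p.1 = q.1 ∧ (p.2 + 1 = q.2 ∨ q.2 + 1 = p.2)) ∨
  (p.2 = q.2 ∧ (p.1 + 1 = q.1 ∨ q.1 + 1 = p.1))

/-- A set of boxes is connected (via shared edges, inside the set). -/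
def SetConnected (S : Set (ℕ × ℕ)) : Prop :=
  ∀ p ∈ S, ∀ q ∈ S,
    Relation.ReflTransGen (fun x y => x ∈ S ∧ y ∈ S ∧ BoxAdjacent x y) p q

/-- `S` contains no 2 × 2 square of boxes. -/
def HasNoSquare (S : Set (ℕ × ℕ)) : Prop :=
  ¬ ∃ a b : ℕ, (a, b) ∈ S ∧ (a + 1, b) ∈ S ∧ (a, b + 1) ∈ S ∧ (a + 1, b + 1) ∈ S

/-- `S` is a removable `ℓ`-rim hook of `μ`: a connected set of `ℓ` boxes of `μ` with no
2 × 2 square whose removal leaves the Young diagram of a partition. -/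
def IsRimHook (ℓ : ℕ) (μ : YPartition) (S : Set (ℕ × ℕ)) : Prop :=
  S ⊆ μ.cells ∧ S.ncard = ℓ ∧ SetConnected S ∧ HasNoSquare S ∧
    ∃ ν : YPartition, ν.cells = μ.cells \ S

/-- `S` is contained in a single row. -/
def HorizontalHook (S : Set (ℕ × ℕ)) : Prop := ∃ a : ℕ, ∀ p ∈ S, p.1 = a

/-- `S` is contained in a single column. -/
def VerticalHook (S : Set (ℕ × ℕ)) : Prop := ∃ b : ℕ, ∀ p ∈ S, p.2 = b

/-- Two sets of boxes are adjacent when some box of one shares an edge with a box of the other. -/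
def SetsAdjacent (R S : Set (ℕ × ℕ)) : Prop := ∃ p ∈ R, ∃ q ∈ S, BoxAdjacent p q

/-- An `ℓ`-core: a partition with no removable `ℓ`-rim hook. -/
def IsCore (ℓ : ℕ) (μ : YPartition) : Prop := ¬ ∃ S : Set (ℕ × ℕ), IsRimHook ℓ μ S

/-- `p` and `q` lie on the same ladder: going down one column step the row increases
by `ℓ - 1`. -/
def SameLadder (ℓ : ℕ) (p q : ℕ × ℕ) : Prop :=
  (q.1 : ℤ) - (p.1 : ℤ) = ((ℓ : ℤ) - 1) * ((p.2 : ℤ) - (q.2 : ℤ))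

/-- The index of the ladder through `p`: the ladder through `(k,1)` has index `k`. -/
def ladderIdx (ℓ : ℕ) (p : ℕ × ℕ) : ℕ := p.1 + (ℓ - 1) * (p.2 - 1)

/-- The residue of position `(a,b)` is `b - a` mod `ℓ`. -/
def res (ℓ : ℕ) (p : ℕ × ℕ) : ℕ := (((p.2 : ℤ) - (p.1 : ℤ)) % (ℓ : ℤ)).toNat

/-- `p` is a removable box of `μ`. -/
def Removable (μ : YPartition) (p : ℕ × ℕ) : Prop :=
  1 ≤ p.1 ∧ p.2 = μ.part p.1 ∧ μ.part (p.1 + 1) < p.2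

/-- `p` is an addable box of `μ`. -/
def Addable (μ : YPartition) (p : ℕ × ℕ) : Prop :=
  1 ≤ p.1 ∧ p.2 = μ.part p.1 + 1 ∧ (p.1 = 1 ∨ p.2 ≤ μ.part (p.1 - 1))

/-- The removable `i`-boxes of `μ`. -/
def RemovableRes (ℓ i : ℕ) (μ : YPartition) : Set (ℕ × ℕ) :=
  {p | Removable μ p ∧ res ℓ p = i}

/-- The addable `i`-boxes of `μ`. -/
def AddableRes (ℓ i : ℕ) (μ : YPartition) : Set (ℕ × ℕ) :=
  {p | Addable μ p ∧ res ℓ p = i}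

/-- Ladder reading order (reflexive): ladders left to right, top to bottom within a ladder.
`LadderLE ℓ p q` means `p` is read before (or equal to) `q`. -/
def LadderLE (ℓ : ℕ) (p q : ℕ × ℕ) : Prop :=
  ladderIdx ℓ p < ladderIdx ℓ q ∨ (ladderIdx ℓ p = ladderIdx ℓ q ∧ p.1 ≤ q.1)

/-- Strict ladder reading order. -/
def LadderLT (ℓ : ℕ) (p q : ℕ × ℕ) : Prop :=
  ladderIdx ℓ p < ladderIdx ℓ q ∨ (ladderIdx ℓ p = ladderIdx ℓ q ∧ p.1 < q.1)

/-- Classical reading order (reflexive): rows from bottom to top.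
`RowLE p q` means `p` is read before (or equal to) `q`. -/
def RowLE (p q : ℕ × ℕ) : Prop := q.1 ≤ p.1

/-- Given a reading order `le`, a set `Rem` of `-` marks and `Add` of `+` marks, a `-` at `p`
survives the cancellation of adjacent `-+` pairs iff every interval of the reading word
starting at `p` contains strictly more `-`'s than `+`'s. -/
def NormalIn (le : ℕ × ℕ → ℕ × ℕ → Prop) (Rem Add : Set (ℕ × ℕ)) (p : ℕ × ℕ) : Prop :=
  p ∈ Rem ∧ ∀ q ∈ Rem ∪ Add, le p q →
    (Add ∩ {s | le p s ∧ le s q}).ncard < (Rem ∩ {s | le p s ∧ le s q}).ncard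

/-- A `+` at `q` survives the cancellation of adjacent `-+` pairs iff every interval of the
reading word ending at `q` contains strictly more `+`'s than `-`'s. -/
def ConormalIn (le : ℕ × ℕ → ℕ × ℕ → Prop) (Rem Add : Set (ℕ × ℕ)) (q : ℕ × ℕ) : Prop :=
  q ∈ Add ∧ ∀ p ∈ Rem ∪ Add, le p q →
    (Rem ∩ {s | le p s ∧ le s q}).ncard < (Add ∩ {s | le p s ∧ le s q}).ncard

/-- Ladder normal `i`-box. -/
def LadderNormal (ℓ i : ℕ) (μ : YPartition) (p : ℕ × ℕ) : Prop :=
  NormalIn (LadderLE ℓ) (RemovableRes ℓ i μ) (AddableRes ℓ i μ) p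

/-- Ladder conormal `i`-box. -/
def LadderConormal (ℓ i : ℕ) (μ : YPartition) (p : ℕ × ℕ) : Prop :=
  ConormalIn (LadderLE ℓ) (RemovableRes ℓ i μ) (AddableRes ℓ i μ) p

/-- Normal `i`-box (classical signature). -/
def ClassNormal (ℓ i : ℕ) (μ : YPartition) (p : ℕ × ℕ) : Prop :=
  NormalIn RowLE (RemovableRes ℓ i μ) (AddableRes ℓ i μ) p

/-- Conormal `i`-box (classical signature). -/
def ClassConormal (ℓ i : ℕ) (μ : YPartition) (p : ℕ × ℕ) : Prop :=
  ConormalIn RowLE (RemovableRes ℓ i μ) (AddableRes ℓ i μ) p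

/-- `ε̂_i(μ)`: number of ladder normal `i`-boxes. -/
def hatEps (ℓ i : ℕ) (μ : YPartition) : ℕ := {p | LadderNormal ℓ i μ p}.ncard

/-- `φ̂_i(μ)`: number of ladder conormal `i`-boxes. -/
def hatPhi (ℓ i : ℕ) (μ : YPartition) : ℕ := {p | LadderConormal ℓ i μ p}.ncard

/-- `ε_i(μ)`: number of normal `i`-boxes. -/
def eps (ℓ i : ℕ) (μ : YPartition) : ℕ := {p | ClassNormal ℓ i μ p}.ncard

/-- `φ_i(μ)`: number of conormal `i`-boxes. -/
def phi (ℓ i : ℕ) (μ : YPartition) : ℕ := {p | ClassConormal ℓ i μ p}.ncard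

/-- The ladder good `i`-box: the leftmost `-` of the reduced ladder `i`-signature. -/
def LadderGood (ℓ i : ℕ) (μ : YPartition) (p : ℕ × ℕ) : Prop :=
  LadderNormal ℓ i μ p ∧ ∀ q, LadderNormal ℓ i μ q → LadderLE ℓ p q

/-- The ladder cogood `i`-box: the rightmost `+` of the reduced ladder `i`-signature. -/
def LadderCogood (ℓ i : ℕ) (μ : YPartition) (p : ℕ × ℕ) : Prop :=
  LadderConormal ℓ i μ p ∧ ∀ q, LadderConormal ℓ i μ q → LadderLE ℓ q p

/-- The good `i`-box (classical). -/
def ClassGood (ℓ i : ℕ) (μ : YPartition) (p : ℕ × ℕ) : Prop :=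
  ClassNormal ℓ i μ p ∧ ∀ q, ClassNormal ℓ i μ q → RowLE p q

/-- The cogood `i`-box (classical). -/
def ClassCogood (ℓ i : ℕ) (μ : YPartition) (p : ℕ × ℕ) : Prop :=
  ClassConormal ℓ i μ p ∧ ∀ q, ClassConormal ℓ i μ q → RowLE q p

/-- The ladder crystal operator `f̂_i` as a relation: `mu = f̂_i lam ≠ 0`. -/
def HatF (ℓ i : ℕ) (lam mu : YPartition) : Prop :=
  ∃ p, LadderCogood ℓ i lam p ∧ mu.cells = insert p lam.cells

/-- The ladder crystal operator `ê_i` as a relation: `mu = ê_i lam ≠ 0`. -/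
def HatE (ℓ i : ℕ) (lam mu : YPartition) : Prop :=
  ∃ p, LadderGood ℓ i lam p ∧ mu.cells = lam.cells \ {p}

/-- The classical crystal operator `f̃_i` as a relation: `mu = f̃_i lam ≠ 0`. -/
def TildeF (ℓ i : ℕ) (lam mu : YPartition) : Prop :=
  ∃ p, ClassCogood ℓ i lam p ∧ mu.cells = insert p lam.cells

/-- The classical crystal operator `ẽ_i` as a relation: `mu = ẽ_i lam ≠ 0`. -/
def TildeE (ℓ i : ℕ) (lam mu : YPartition) : Prop :=
  ∃ p, ClassGood ℓ i lam p ∧ mu.cells = lam.cells \ {p}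

/-- `n`-fold composition of a relation. -/
def RelIter {α : Type} (r : α → α → Prop) : ℕ → α → α → Prop
  | 0 => fun a b => a = b
  | n + 1 => fun a b => ∃ c, r a c ∧ RelIter r n c b

/-- The empty partition. -/
def emptyP : YPartition where
  part := fun _ => 0
  zero_at_zero := rfl
  antitone := fun _ _ _ _ => le_rfl
  eventually_zero := ⟨0, fun _ _ => rfl⟩

/-- `μ` is a node of the ladder crystal `B(Λ₀)^L`: it is obtained from the empty
partition by finitely many applications of the operators `f̂_i`, `0 ≤ i < ℓ`. -/
def LadderNode (ℓ : ℕ) (μ : YPartition) : Prop :=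
  Relation.ReflTransGen (fun a b => ∃ i : ℕ, i < ℓ ∧ HatF ℓ i a b) emptyP μ

/-- The type I locking condition at `(a,b)`: every unoccupied position on the ladder of
`(a,b)` lying below it has an unoccupied position directly above it. -/
def LadderClear (ℓ : ℕ) (μ : YPartition) (a b : ℕ) : Prop :=
  ∀ c d : ℕ, 1 ≤ c → 1 ≤ d → SameLadder ℓ (a, b) (c, d) → a < c →
    (c, d) ∉ μ.cells → (c - 1, d) ∉ μ.cells

/-- Locked boxes of `μ`. -/
inductive Locked (ℓ : ℕ) (μ : YPartition) : ℕ × ℕ → Prop where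
  | typeI_top : ∀ b : ℕ, (1, b) ∈ μ.cells → LadderClear ℓ μ 1 b → Locked ℓ μ (1, b)
  | typeI_up : ∀ a b : ℕ, (a + 1, b) ∈ μ.cells → Locked ℓ μ (a, b) →
      LadderClear ℓ μ (a + 1) b → Locked ℓ μ (a + 1, b)
  | typeII : ∀ a b b' : ℕ, (a, b) ∈ μ.cells → b < b' → Locked ℓ μ (a, b') → Locked ℓ μ (a, b)

/-- Number of boxes of `μ` on the `k`-th ladder. -/
def ladderCount (ℓ : ℕ) (μ : YPartition) (k : ℕ) : ℕ :=
  (μ.cells ∩ {p | ladderIdx ℓ p = k}).ncard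

/-- `lam` and `mu` lie in the same regularization class: they have the same number of
boxes on every ladder. -/
def SameRegClass (ℓ : ℕ) (lam mu : YPartition) : Prop :=
  ∀ k : ℕ, ladderCount ℓ lam k = ladderCount ℓ mu k

/-- The boxes of `μ` are top-justified on each ladder. -/
def TopJustified (ℓ : ℕ) (μ : YPartition) : Prop :=
  ∀ p ∈ μ.cells, ∀ q : ℕ × ℕ, 1 ≤ q.1 → 1 ≤ q.2 →
    ladderIdx ℓ q = ladderIdx ℓ p → q.1 < p.1 → q ∈ μ.cells

/-- `mu = R lam`: the regularization of `lam`, obtained by moving every box of `lam` to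
the topmost unoccupied positions of its ladder. -/
def IsRegularization (ℓ : ℕ) (lam mu : YPartition) : Prop :=
  SameRegClass ℓ lam mu ∧ TopJustified ℓ mu

/-- Dominance order on partitions. -/
def DomLE (lam mu : YPartition) : Prop :=
  ∀ j : ℕ, ∑ i ∈ Finset.Icc 1 j, lam.part i ≤ ∑ i ∈ Finset.Icc 1 j, mu.part i

/-- All (positive) positions on the `k`-th ladder. -/
def LadderPositions (ℓ k : ℕ) : Set (ℕ × ℕ) :=
  {p | 1 ≤ p.1 ∧ 1 ≤ p.2 ∧ ladderIdx ℓ p = k}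

/-- The set of locked boxes of `μ`. -/
def lockedCells (ℓ : ℕ) (μ : YPartition) : Set (ℕ × ℕ) := {p | Locked ℓ μ p}

/-- The number of unlocked boxes of `μ` on the `k`-th ladder. -/
def unlockedCount (ℓ : ℕ) (μ : YPartition) (k : ℕ) : ℕ :=
  ((μ.cells ∩ LadderPositions ℓ k) \ lockedCells ℓ μ).ncard

/-- The diagram `S μ`: locked boxes stay put, and on each ladder the unlocked boxes are
moved into the lowest positions of that ladder not occupied by locked boxes. -/
def SCells (ℓ : ℕ) (μ : YPartition) : Set (ℕ × ℕ) :=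
  lockedCells ℓ μ ∪
    {p | 1 ≤ p.1 ∧ 1 ≤ p.2 ∧ p ∉ lockedCells ℓ μ ∧
      ((LadderPositions ℓ (ladderIdx ℓ p) ∩ {q | p.1 < q.1}) \ lockedCells ℓ μ).ncard
        < unlockedCount ℓ μ (ladderIdx ℓ p)}

/-- `μ` is `ℓ`-regular: no part occurs `ℓ` or more times. -/
def IsRegular (ℓ : ℕ) (μ : YPartition) : Prop :=
  ∀ a : ℕ, 1 ≤ a → 0 < μ.part (a + (ℓ - 1)) → μ.part (a + (ℓ - 1)) < μ.part a

/-- Removal of a single horizontal or vertical `ℓ`-rim hook. -/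
def RemoveHV (ℓ : ℕ) (lam mu : YPartition) : Prop :=
  ∃ S : Set (ℕ × ℕ), IsRimHook ℓ lam S ∧ (HorizontalHook S ∨ VerticalHook S) ∧
    mu.cells = lam.cells \ S

/-- Condition (1): every removable `ℓ`-rim hook is horizontal or vertical. -/
def Cond1 (ℓ : ℕ) (μ : YPartition) : Prop :=
  ∀ S : Set (ℕ × ℕ), IsRimHook ℓ μ S → HorizontalHook S ∨ VerticalHook S

/-- Condition (2): no vertical (resp. horizontal) `ℓ`-rim hook `R` of `μ` together with an
adjacent horizontal (resp. vertical) `ℓ`-rim hook `S` of `μ \ R` . -/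
def Cond2 (ℓ : ℕ) (μ : YPartition) : Prop :=
  ¬ ∃ (R S : Set (ℕ × ℕ)) (ν : YPartition), IsRimHook ℓ μ R ∧ ν.cells = μ.cells \ R ∧
    IsRimHook ℓ ν S ∧ SetsAdjacent R S ∧
    ((VerticalHook R ∧ HorizontalHook S) ∨ (HorizontalHook R ∧ VerticalHook S))

/-- A generalized `ℓ`-partition: conditions (1) and (2) hold after removing any sequence of
horizontal and vertical `ℓ`-rim hooks (including the empty sequence). -/
def IsGenLPartition (ℓ : ℕ) (lam : YPartition) : Prop :=
  ∀ mu : YPartition, Relation.ReflTransGen (RemoveHV ℓ) lam mu → Cond1 ℓ mu ∧ Cond2 ℓ mu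

/-- The `t`-th row (from the top) of the bottom block of the decomposition
`(μ, r, s, ρ, σ)`: the number of values `v ∈ [1, s+1]` whose column block still reaches
row `t`; column block `v` consists of `σ_v·ℓ + (s+1−v)(ℓ−1)` rows of length `≥ v`. -/
def bottomPart (ℓ s : ℕ) (σ : YPartition) (t : ℕ) : ℕ :=
  ((Finset.Icc 1 (s + 1)).filter fun v => t ≤ σ.part v * ℓ + (s + 1 - v) * (ℓ - 1)).card

/-- The `i`-th part of the partition corresponding to the data `(μ, r, s, ρ, σ)`. -/
def decompPart (ℓ : ℕ) (mu : YPartition) (r s : ℕ) (ρ σ : YPartition) (i : ℕ) : ℕ :=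
  if i = 0 then 0
  else if i ≤ r + 1 then s + mu.part 1 + (r + 1 - i) * (ℓ - 1) + ρ.part i * ℓ
  else if i ≤ r + max mu.length 1 then s + mu.part (i - r)
  else bottomPart ℓ s σ (i - (r + max mu.length 1))

/-- Admissibility of the decomposition data `(μ, r, s, ρ, σ)`. -/
def GoodData (ℓ : ℕ) (mu : YPartition) (r s : ℕ) (ρ σ : YPartition) : Prop :=
  IsCore ℓ mu ∧ mu.part 1 < mu.part 2 + (ℓ - 1) ∧ mu.colLen 1 < mu.colLen 2 + (ℓ - 1) ∧
  ρ.length ≤ r + 1 ∧ σ.length ≤ s + 1 ∧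
  (mu.cells = ∅ → ρ.part (r + 1) = 0 ∨ σ.part (s + 1) = 0)

/-- `lam ≈ (μ, r, s, ρ, σ)`. -/
def Decomposes (ℓ : ℕ) (lam mu : YPartition) (r s : ℕ) (ρ σ : YPartition) : Prop :=
  ∀ i : ℕ, lam.part i = decompPart ℓ mu r s ρ σ i

/-- Removal of a single `ℓ`-rim hook. -/
def RemoveHook (ℓ : ℕ) (lam mu : YPartition) : Prop :=
  ∃ S : Set (ℕ × ℕ), IsRimHook ℓ lam S ∧ mu.cells = lam.cells \ S

/-- `lam` has `ℓ`-core `nu` and `ℓ`-weight `w`. -/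
def HasCoreAndWeight (ℓ : ℕ) (lam nu : YPartition) (w : ℕ) : Prop :=
  IsCore ℓ nu ∧ RelIter (RemoveHook ℓ) w lam nu

/-- An L-partition. -/
def IsLPartition (ℓ : ℕ) (lam : YPartition) : Prop :=
  ¬ ∃ p : ℕ × ℕ, p ∈ lam.cells ∧ ℓ ∣ lam.hook p.1 p.2 ∧
    (lam.arm p.1 p.2 < (ℓ - 1) * lam.leg p.1 p.2 ∨
     lam.leg p.1 p.2 < (ℓ - 1) * lam.arm p.1 p.2)

end YPartition

open YPartition
section Abstract

variable {K : Type*} [LinearOrder K]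

theorem ncard_inter_filter (κ : ℕ × ℕ → K) (R : Finset (ℕ × ℕ)) (p q : ℕ × ℕ) :
    ((R : Set (ℕ × ℕ)) ∩ {s | κ p ≤ κ s ∧ κ s ≤ κ q}).ncard =
      (R.filter fun s => κ p ≤ κ s ∧ κ s ≤ κ q).card := by
  rw [← Set.ncard_coe_finset]
  congr 1
  ext s
  simp

/-- If a minus `q` lies before the normal minus `p` with no plus in between, `q` is normal. -/
theorem normal_propagate (κ : ℕ × ℕ → K) (R A : Set (ℕ × ℕ)) (hR : R.Finite) (hA : A.Finite)
    (p q : ℕ × ℕ) (hp : NormalIn (fun x y => κ x ≤ κ y) R A p) (hq : q ∈ R) (hqp : κ q < κ p)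
    (hno : ∀ s ∈ A, κ q ≤ κ s → κ s ≤ κ p → False) :
    NormalIn (fun x y => κ x ≤ κ y) R A q := by
  refine ⟨hq, fun r hr hqr => ?_⟩
  rcases le_or_gt (κ p) (κ r) with h | h
  · refine lt_of_le_of_lt (Set.ncard_le_ncard ?_ (hA.subset Set.inter_subset_left))
      (lt_of_lt_of_le (hp.2 r hr h) (Set.ncard_le_ncard ?_ (hR.subset Set.inter_subset_left)))
    · rintro s ⟨hs, h1, h2⟩
      refine ⟨hs, ?_, h2⟩
      by_contra h3
      exact hno s hs h1 (le_of_not_ge h3)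
    · rintro s ⟨hs, h1, h2⟩
      exact ⟨hs, hqp.le.trans h1, h2⟩
  · have : A ∩ {s | κ q ≤ κ s ∧ κ s ≤ κ r} = ∅ := by
      ext s
      simp only [Set.mem_inter_iff, Set.mem_ofPred_eq, Set.mem_empty_iff_false, iff_false]
      rintro ⟨hs, h1, h2⟩
      exact hno s hs h1 (h2.trans h.le)
    rw [this, Set.ncard_empty, Set.ncard_pos (hR.subset Set.inter_subset_left)]
    exact ⟨q, hq, le_rfl, hqr⟩

theorem open_bad (κ : ℕ × ℕ → K) (R A : Finset (ℕ × ℕ))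
    (x y : K)
    (h : (A.filter fun s => x < κ s ∧ κ s < y).card < (R.filter fun s => x < κ s ∧ κ s < y).card) :
    ∃ q ∈ R ∪ A, x < κ q ∧ κ q < y ∧
      (A.filter fun s => κ q ≤ κ s ∧ κ s < y).card < (R.filter fun s => κ q ≤ κ s ∧ κ s < y).card := by
  have hne : ((R ∪ A).filter fun s => x < κ s ∧ κ s < y).Nonempty := by
    have : 0 < (R.filter fun s => x < κ s ∧ κ s < y).card := by omega
    obtain ⟨z, hz⟩ := Finset.card_pos.1 this
    simp only [Finset.mem_filter] at hz
    exact ⟨z, by simp [hz]⟩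
  obtain ⟨q, hq, hmin⟩ := Finset.exists_min_image _ κ hne
  simp only [Finset.mem_filter, and_imp] at hq hmin
  refine ⟨q, hq.1, hq.2.1, hq.2.2, ?_⟩
  have e1 : (A.filter fun s => κ q ≤ κ s ∧ κ s < y) = (A.filter fun s => x < κ s ∧ κ s < y) := by
    apply Finset.filter_congr
    intro s hs
    constructor
    · rintro ⟨h1, h2⟩; exact ⟨hq.2.1.trans_le h1, h2⟩
    · rintro ⟨h1, h2⟩; exact ⟨hmin s (by simp [hs]) h1 h2, h2⟩
  have e2 : (R.filter fun s => κ q ≤ κ s ∧ κ s < y) = (R.filter fun s => x < κ s ∧ κ s < y) := by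
    apply Finset.filter_congr
    intro s hs
    constructor
    · rintro ⟨h1, h2⟩; exact ⟨hq.2.1.trans_le h1, h2⟩
    · rintro ⟨h1, h2⟩; exact ⟨hmin s (by simp [hs]) h1 h2, h2⟩
  rw [e1, e2]; exact h

theorem card_filter_split {α : Type*} [DecidableEq α] (R : Finset α) (P Q S : α → Prop)
    [DecidablePred P] [DecidablePred Q] [DecidablePred S]
    (h1 : ∀ s ∈ R, P s ↔ Q s ∨ S s) (h2 : ∀ s ∈ R, Q s → S s → False) :
    (R.filter P).card = (R.filter Q).card + (R.filter S).card := by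
  rw [Finset.filter_congr h1, Finset.filter_or, Finset.card_union_of_disjoint]
  rw [Finset.disjoint_filter]
  exact h2

theorem no_bad (κ : ℕ × ℕ → K) (R A : Finset (ℕ × ℕ))
    (hinj : ∀ x ∈ R ∪ A, ∀ y ∈ R ∪ A, κ x = κ y → x = y) (hdis : Disjoint R A)
    (p : ℕ × ℕ) (hp : NormalIn (fun x y => κ x ≤ κ y) (R : Set _) A p)
    (hgood : ∀ q, NormalIn (fun x y => κ x ≤ κ y) (R : Set _) A q → κ p ≤ κ q)
    (q : ℕ × ℕ) (hq : q ∈ R ∪ A) (hqp : κ q < κ p) :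
    (R.filter fun s => κ q ≤ κ s ∧ κ s < κ p).card ≤
      (A.filter fun s => κ q ≤ κ s ∧ κ s < κ p).card := by
  by_contra hbad
  push Not at hbad
  have hne : ((R ∪ A).filter fun q => κ q < κ p ∧
      (A.filter fun s => κ q ≤ κ s ∧ κ s < κ p).card <
      (R.filter fun s => κ q ≤ κ s ∧ κ s < κ p).card).Nonempty :=
    ⟨q, by rw [Finset.mem_filter]; exact ⟨hq, hqp, hbad⟩⟩
  clear hq hqp hbad q
  obtain ⟨q, hq, hmax⟩ := Finset.exists_max_image _ κ hne
  simp only [Finset.mem_filter, and_imp] at hq hmax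
  obtain ⟨hq, hqp, hbad⟩ := hq
  have key : ∀ r, κ q ≤ κ r →
      (R.filter fun s => κ r < κ s ∧ κ s < κ p).card ≤
      (A.filter fun s => κ r < κ s ∧ κ s < κ p).card := by
    intro r hr
    by_contra h
    push Not at h
    obtain ⟨z, hz, h1, h2, h3⟩ := open_bad κ R A _ _ h
    exact absurd (hmax z hz h2 h3) (not_le.2 (hr.trans_lt h1))
  have splitq : ∀ (T : Finset (ℕ × ℕ)) (r : ℕ × ℕ), κ q ≤ κ r → κ r < κ p →
      (T.filter fun s => κ q ≤ κ s ∧ κ s < κ p).card =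
      (T.filter fun s => κ q ≤ κ s ∧ κ s ≤ κ r).card +
      (T.filter fun s => κ r < κ s ∧ κ s < κ p).card := by
    intro T r h1 h2
    apply card_filter_split
    · intro s _
      constructor
      · rintro ⟨h3, h4⟩
        rcases le_or_gt (κ s) (κ r) with h | h
        · exact Or.inl ⟨h3, h⟩
        · exact Or.inr ⟨h, h4⟩
      · rintro (⟨h3, h4⟩ | ⟨h3, h4⟩)
        · exact ⟨h3, h4.trans_lt h2⟩
        · exact ⟨h1.trans h3.le, h4⟩
    · rintro s _ ⟨_, h3⟩ ⟨h4, _⟩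
      exact absurd h3 (not_le.2 h4)
  have splitp : ∀ (T : Finset (ℕ × ℕ)) (r : ℕ × ℕ), κ p ≤ κ r →
      (T.filter fun s => κ q ≤ κ s ∧ κ s ≤ κ r).card =
      (T.filter fun s => κ q ≤ κ s ∧ κ s < κ p).card +
      (T.filter fun s => κ p ≤ κ s ∧ κ s ≤ κ r).card := by
    intro T r h1
    apply card_filter_split
    · intro s _
      constructor
      · rintro ⟨h3, h4⟩
        rcases lt_or_ge (κ s) (κ p) with h | h
        · exact Or.inl ⟨h3, h⟩
        · exact Or.inr ⟨h, h4⟩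
      · rintro (⟨h3, h4⟩ | ⟨h3, h4⟩)
        · exact ⟨h3, h4.le.trans h1⟩
        · exact ⟨hqp.le.trans h3, h4⟩
    · rintro s _ ⟨_, h3⟩ ⟨h4, _⟩
      exact absurd h3 (not_lt.2 h4)
  have hqR : q ∈ R := by
    by_contra hqR
    have hqA : q ∈ A := by simpa [hqR] using hq
    have s1 := splitq A q le_rfl hqp
    have s2 := splitq R q le_rfl hqp
    have k := key q le_rfl
    have h1 : (R.filter fun s => κ q ≤ κ s ∧ κ s ≤ κ q).card = 0 := by
      rw [Finset.card_eq_zero, Finset.filter_eq_empty_iff]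
      rintro s hs ⟨h1, h2⟩
      have := hinj s (by simp [hs]) q hq (le_antisymm h2 h1)
      subst this
      exact hqR hs
    omega
  have hn : NormalIn (fun x y => κ x ≤ κ y) (R : Set _) A q := by
    refine ⟨hqR, fun r hr hqr => ?_⟩
    rw [ncard_inter_filter κ, ncard_inter_filter κ]
    rcases lt_or_ge (κ r) (κ p) with h | h
    · have s1 := splitq A r hqr h
      have s2 := splitq R r hqr h
      have k := key r hqr
      omega
    · have s1 := splitp A r h
      have s2 := splitp R r h
      have := hp.2 r hr h
      rw [ncard_inter_filter κ, ncard_inter_filter κ] at this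
      omega
  exact absurd (hgood q hn) (not_le.2 hqp)

theorem good_cogood (κ : ℕ × ℕ → K) (R A : Finset (ℕ × ℕ))
    (hinj : ∀ x ∈ R ∪ A, ∀ y ∈ R ∪ A, κ x = κ y → x = y) (hdis : Disjoint R A)
    (p : ℕ × ℕ) (hp : NormalIn (fun x y => κ x ≤ κ y) (R : Set _) A p)
    (hgood : ∀ q, NormalIn (fun x y => κ x ≤ κ y) (R : Set _) A q → κ p ≤ κ q)
    (R' A' : Set (ℕ × ℕ)) (hR' : R' = (R : Set _) \ {p}) (hA' : A' = insert p (A : Set _)) :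
    ConormalIn (fun x y => κ x ≤ κ y) R' A' p ∧
    ∀ q, ConormalIn (fun x y => κ x ≤ κ y) R' A' q → κ q ≤ κ p := by
  have hpR : p ∈ R := hp.1
  have hpA : p ∉ A := Finset.disjoint_left.1 hdis hpR
  have hR2 : R' = ((R.erase p : Finset _) : Set _) := by rw [hR', Finset.coe_erase]
  have hA2 : A' = ((insert p A : Finset _) : Set _) := by rw [hA', Finset.coe_insert]
  subst hR2 hA2
  clear hR' hA'
  constructor
  · refine ⟨by simp, fun q hq hqp => ?_⟩
    rw [ncard_inter_filter κ, ncard_inter_filter κ]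
    have hq' : q ∈ R ∪ A := by
      simp only [Finset.coe_erase, Finset.coe_insert, Set.mem_union, Set.mem_sdiff,
        Set.mem_insert_iff, Finset.mem_coe, Set.mem_singleton_iff] at hq
      rw [Finset.mem_union]
      rcases hq with h | h | h
      · exact Or.inl h.1
      · subst h; exact Or.inl hpR
      · exact Or.inr h
    have hp' : p ∈ R ∪ A := by simp [hpR]
    have e1 : ((R.erase p).filter fun s => κ q ≤ κ s ∧ κ s ≤ κ p) =
        R.filter fun s => κ q ≤ κ s ∧ κ s < κ p := by
      ext s
      simp only [Finset.mem_filter, Finset.mem_erase]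
      constructor
      · rintro ⟨⟨h1, h2⟩, h3, h4⟩
        exact ⟨h2, h3, lt_of_le_of_ne h4 fun h => h1 (hinj s (by simp [h2]) p hp' h)⟩
      · rintro ⟨h1, h2, h3⟩
        exact ⟨⟨fun h => by subst h; exact lt_irrefl _ h3, h1⟩, h2, h3.le⟩
    have e2 : ((insert p A).filter fun s => κ q ≤ κ s ∧ κ s ≤ κ p) =
        insert p (A.filter fun s => κ q ≤ κ s ∧ κ s < κ p) := by
      ext s
      simp only [Finset.mem_filter, Finset.mem_insert]
      constructor
      · rintro ⟨h1 | h1, h2, h3⟩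
        · exact Or.inl h1
        · exact Or.inr ⟨h1, h2, lt_of_le_of_ne h3 fun h => hpA
            (by have := hinj s (by simp [h1]) p hp' h; subst this; exact h1)⟩
      · rintro (h1 | ⟨h1, h2, h3⟩)
        · subst h1; exact ⟨Or.inl rfl, hqp, le_rfl⟩
        · exact ⟨Or.inr h1, h2, h3.le⟩
    rw [e1, e2, Finset.card_insert_of_notMem (by simp [hpA])]
    rcases lt_or_ge (κ q) (κ p) with h | h
    · have := no_bad κ R A hinj hdis p hp hgood q hq' h
      omega
    · have : (R.filter fun s => κ q ≤ κ s ∧ κ s < κ p) = ∅ := by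
        rw [Finset.filter_eq_empty_iff]
        rintro s _ ⟨h1, h2⟩
        exact absurd h2 (not_lt.2 (h.trans h1))
      rw [this]
      simp
  · intro r hr
    by_contra hpr
    push Not at hpr
    have hrA : r ∈ A := by
      have := hr.1
      simp only [Finset.coe_insert, Set.mem_insert_iff, Finset.mem_coe] at this
      rcases this with h | h
      · subst h; exact absurd hpr (lt_irrefl _)
      · exact h
    have hn := hp.2 r (Or.inr hrA) hpr.le
    rw [ncard_inter_filter κ, ncard_inter_filter κ] at hn
    have hne : ((R ∪ A).filter fun s => κ p < κ s).Nonempty :=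
      ⟨r, by simp [hrA, hpr]⟩
    obtain ⟨z, hz, hmin⟩ := Finset.exists_min_image _ κ hne
    simp only [Finset.mem_filter, and_imp] at hz hmin
    have hzr := hmin r (by simp [hrA]) hpr
    have hzm : z ∈ ((R.erase p : Finset _) : Set (ℕ × ℕ)) ∪ ((insert p A : Finset _) : Set _) := by
      have hzp : z ≠ p := fun h => by subst h; exact lt_irrefl _ hz.2
      have := hz.1
      rw [Finset.mem_union] at this
      rcases this with h | h
      · left; simp [h, hzp]
      · right; simp [h]
    have hc := hr.2 z hzm hzr
    rw [ncard_inter_filter κ, ncard_inter_filter κ] at hc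
    have e1 : ((R.erase p).filter fun s => κ z ≤ κ s ∧ κ s ≤ κ r) =
        (R.filter fun s => κ p ≤ κ s ∧ κ s ≤ κ r).erase p := by
      ext s
      simp only [Finset.mem_filter, Finset.mem_erase]
      constructor
      · rintro ⟨⟨h1, h2⟩, h3, h4⟩
        exact ⟨h1, h2, hz.2.le.trans h3, h4⟩
      · rintro ⟨h1, h2, h3, h4⟩
        refine ⟨⟨h1, h2⟩, hmin s (by simp [h2]) ?_, h4⟩
        exact lt_of_le_of_ne h3 fun h => h1 (hinj s (by simp [h2]) p (by simp [hpR]) h.symm)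
    have e2 : ((insert p A).filter fun s => κ z ≤ κ s ∧ κ s ≤ κ r) =
        A.filter fun s => κ p ≤ κ s ∧ κ s ≤ κ r := by
      ext s
      simp only [Finset.mem_filter, Finset.mem_insert]
      constructor
      · rintro ⟨h1 | h1, h2, h3⟩
        · subst h1; exact absurd hz.2 (not_lt.2 h2)
        · exact ⟨h1, hz.2.le.trans h2, h3⟩
      · rintro ⟨h1, h2, h3⟩
        refine ⟨Or.inr h1, hmin s (by simp [h1]) ?_, h3⟩
        exact lt_of_le_of_ne h2 fun h => hpA
          (by have := hinj s (by simp [h1]) p (by simp [hpR]) h.symm; subst this; exact h1)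
    rw [e1, e2, Finset.card_erase_of_mem (by simp [hpR, hpr.le])] at hc
    omega

end Abstract

/-- No box has hook length equal to `ℓ = n + 1` times its arm length. -/
def NoBad (n : ℕ) (μ : YPartition) : Prop :=
  ∀ a b m d : ℕ, 1 ≤ a → 1 ≤ b → 1 ≤ m → μ.part a = b + m → d + 1 = a + n * m →
    b ≤ μ.part d → b ≤ μ.part (d + 1)

theorem le_colLen_iff (μ : YPartition) (a b : ℕ) (ha : 1 ≤ a) (hb : 1 ≤ b) :
    a ≤ μ.colLen b ↔ b ≤ μ.part a := by
  have hfin : {a : ℕ | 1 ≤ a ∧ b ≤ μ.part a}.Finite := by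
    obtain ⟨N, hN⟩ := μ.eventually_zero
    refine (Set.finite_lt_nat N).subset ?_
    rintro x ⟨_, hx⟩
    show x < N
    by_contra h
    have := hN x (by omega)
    omega
  have hc : μ.colLen b = {a : ℕ | 1 ≤ a ∧ b ≤ μ.part a}.ncard := rfl
  rw [hc]
  have hI : ∀ k, (Set.Icc 1 k : Set ℕ).ncard = k := by
    intro k
    rw [← Finset.coe_Icc, Set.ncard_coe_finset]; simp
  constructor
  · intro h
    by_contra h2
    have : {a : ℕ | 1 ≤ a ∧ b ≤ μ.part a}.ncard ≤ (Set.Icc 1 (a - 1) : Set ℕ).ncard := by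
      apply Set.ncard_le_ncard _ (Set.finite_Icc _ _)
      rintro x ⟨h3, h4⟩
      refine ⟨h3, ?_⟩
      by_contra h5
      have := μ.antitone a x ha (by omega)
      omega
    rw [hI] at this
    omega
  · intro h
    have : (Set.Icc 1 a : Set ℕ).ncard ≤ {a : ℕ | 1 ≤ a ∧ b ≤ μ.part a}.ncard := by
      apply Set.ncard_le_ncard _ hfin
      rintro x ⟨h3, h4⟩
      exact ⟨h3, h.trans (μ.antitone x a h3 h4)⟩
    rwa [hI] at this

theorem step_dvd {ℓ x y : ℕ} (hx : ℓ ∣ x) (hy : ℓ ∣ y) (h : x < y) : x + ℓ ≤ y := by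
  have : ℓ ∣ y - x := Nat.dvd_sub hy hx
  have := Nat.le_of_dvd (by omega) this
  omega

theorem noBad_of_JM (n : ℕ) (hn : 2 ≤ n) (μ : YPartition) (h : IsJM (n + 1) μ) : NoBad n μ := by
  intro a b m d ha hb hm hpa hd hbd
  by_contra hlt
  have hnm : 2 * m ≤ n * m := Nat.mul_le_mul_right m hn
  have hcol : μ.colLen b = d := by
    have h1 := (le_colLen_iff μ d b (by omega) hb).2 hbd
    have h2 := mt (le_colLen_iff μ (d + 1) b (by omega) hb).1 hlt
    omega
  have hhook : μ.hook a b = (n + 1) * m := by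
    unfold YPartition.hook
    rw [hcol, add_mul]; omega
  have hmem : (a, b) ∈ μ.cells := ⟨ha, hb, by show b ≤ μ.part a; omega⟩
  by_cases hrow : ∀ y, (a, y) ∈ μ.cells → (n + 1) ∣ μ.hook a y
  · have key : ∀ j, j ≤ m → (n + 1) * (j + 1) ≤ μ.hook a (b + m - j) := by
      intro j
      induction j with
      | zero =>
        intro _
        have := Nat.le_of_dvd (by unfold YPartition.hook; omega)
          (hrow (b + m - 0) ⟨ha, by show 1 ≤ b + m - 0; omega, by show b + m - 0 ≤ μ.part a; omega⟩)
        omega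
      | succ j ih =>
        intro hj
        have ih := ih (by omega)
        have h1 := hrow (b + m - j)
          ⟨ha, by show 1 ≤ b + m - j; omega, by show b + m - j ≤ μ.part a; omega⟩
        have h2 := hrow (b + m - (j + 1))
          ⟨ha, by show 1 ≤ b + m - (j + 1); omega, by show b + m - (j + 1) ≤ μ.part a; omega⟩
        have h3 : μ.hook a (b + m - j) < μ.hook a (b + m - (j + 1)) := by
          have c1 : a ≤ μ.colLen (b + m - j) :=
            (le_colLen_iff μ _ _ ha (by omega)).2 (by omega)
          have c2 : μ.colLen (b + m - j) ≤ μ.colLen (b + m - (j + 1)) := by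
            rw [le_colLen_iff μ _ _ (by omega) (by omega)]
            have := (le_colLen_iff μ (μ.colLen (b + m - j)) (b + m - j) (by omega) (by omega)).1 le_rfl
            omega
          unfold YPartition.hook
          omega
        have h4 := step_dvd h1 h2 h3
        rw [mul_add]
        omega
    have := key m le_rfl
    rw [Nat.add_sub_cancel, hhook, mul_add] at this
    omega
  · push Not at hrow
    obtain ⟨y, hy, hyn⟩ := hrow
    have hcolm : ∀ x, (x, b) ∈ μ.cells → (n + 1) ∣ μ.hook x b := by
      intro x hx
      by_contra hxn
      exact h ⟨a, b, y, x, hmem, hy, hx, hhook ▸ Dvd.intro _ rfl, hyn, hxn⟩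
    have key : ∀ j, j + a ≤ d → (n + 1) * (j + 1) ≤ μ.hook (d - j) b := by
      intro j
      induction j with
      | zero =>
        intro _
        have := Nat.le_of_dvd (by unfold YPartition.hook; omega)
          (hcolm (d - 0) ⟨by show 1 ≤ d - 0; omega, hb, hbd⟩)
        omega
      | succ j ih =>
        intro hj
        have ih := ih (by omega)
        have a1 := μ.antitone (d - j) d (by omega) (by omega)
        have a2 := μ.antitone (d - (j + 1)) (d - j) (by omega) (by omega)
        have h1 := hcolm (d - j)
          ⟨by show 1 ≤ d - j; omega, hb, by show b ≤ μ.part (d - j); omega⟩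
        have h2 := hcolm (d - (j + 1))
          ⟨by show 1 ≤ d - (j + 1); omega, hb, by show b ≤ μ.part (d - (j + 1)); omega⟩
        have h3 : μ.hook (d - j) b < μ.hook (d - (j + 1)) b := by
          unfold YPartition.hook
          rw [hcol]
          omega
        have h4 := step_dvd h1 h2 h3
        rw [mul_add]
        omega
    have := key (d - a) (by omega)
    rw [show d - (d - a) = a by omega, hhook, show d - a + 1 = n * m by omega] at this
    have := Nat.le_of_mul_le_mul_left this (by omega)
    omega

theorem ladderIdx_eq (n : ℕ) (p : ℕ × ℕ) : ladderIdx (n + 1) p = p.1 + n * (p.2 - 1) := rfl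

theorem res_eq_iff_dvd (n : ℕ) (p q : ℕ × ℕ) :
    res (n + 1) p = res (n + 1) q ↔
      ((n + 1 : ℕ) : ℤ) ∣ ((p.2 : ℤ) - p.1) - ((q.2 : ℤ) - q.1) := by
  unfold res
  have h1 := Int.emod_nonneg ((p.2 : ℤ) - p.1) (show ((n + 1 : ℕ) : ℤ) ≠ 0 by omega)
  have h2 := Int.emod_nonneg ((q.2 : ℤ) - q.1) (show ((n + 1 : ℕ) : ℤ) ≠ 0 by omega)
  constructor
  · intro h
    apply Int.dvd_of_emod_eq_zero
    exact Int.emod_eq_emod_iff_emod_sub_eq_zero.1 (by omega)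
  · intro h
    rw [Int.emod_eq_emod_iff_emod_sub_eq_zero.2 (Int.emod_eq_zero_of_dvd h)]

theorem res_eq_iff (n : ℕ) (p q : ℕ × ℕ) (hp : 1 ≤ p.2) (hq : 1 ≤ q.2) :
    res (n + 1) p = res (n + 1) q ↔
      ((n + 1 : ℕ) : ℤ) ∣ (ladderIdx (n + 1) p : ℤ) - ladderIdx (n + 1) q := by
  rw [res_eq_iff_dvd, ladderIdx_eq, ladderIdx_eq]
  obtain ⟨a, b⟩ := p
  obtain ⟨c, d⟩ := q
  obtain ⟨b, rfl⟩ := Nat.exists_eq_add_of_le hp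
  obtain ⟨d, rfl⟩ := Nat.exists_eq_add_of_le hq
  simp only [Nat.add_sub_cancel_left]
  have : ((a + n * b : ℕ) : ℤ) - ((c + n * d : ℕ) : ℤ) =
      ((n + 1 : ℕ) : ℤ) * (b - d) - ((((1 + b : ℕ) : ℤ) - a) - (((1 + d : ℕ) : ℤ) - c)) := by
    push_cast; ring
  rw [this]
  exact (dvd_sub_right (Dvd.intro _ rfl)).symm

theorem res_ne_of_adj (n : ℕ) (hn : 2 ≤ n) (p q : ℕ × ℕ)
    (h : (p.2 : ℤ) - p.1 = (q.2 : ℤ) - q.1 + 1) : res (n + 1) p ≠ res (n + 1) q := by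
  intro h2
  rw [res_eq_iff_dvd] at h2
  have := Int.le_of_dvd (by omega) h2
  omega

/-- Reading key. -/
def lkey (ℓ : ℕ) (p : ℕ × ℕ) : ℕ ×ₗ ℕ := toLex (ladderIdx ℓ p, p.1)

theorem lkey_le (ℓ : ℕ) (p q : ℕ × ℕ) : lkey ℓ p ≤ lkey ℓ q ↔
    ladderIdx ℓ p < ladderIdx ℓ q ∨ (ladderIdx ℓ p = ladderIdx ℓ q ∧ p.1 ≤ q.1) :=
  Prod.Lex.le_iff

theorem lkey_lt (ℓ : ℕ) (p q : ℕ × ℕ) : lkey ℓ p < lkey ℓ q ↔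
    ladderIdx ℓ p < ladderIdx ℓ q ∨ (ladderIdx ℓ p = ladderIdx ℓ q ∧ p.1 < q.1) :=
  Prod.Lex.lt_iff

theorem ladderLE_eq (ℓ : ℕ) : LadderLE ℓ = fun x y => lkey ℓ x ≤ lkey ℓ y := by
  funext p q
  exact propext (lkey_le ℓ p q).symm

theorem lkey_inj (n : ℕ) (hn : 2 ≤ n) (p q : ℕ × ℕ) (hp : 1 ≤ p.2) (hq : 1 ≤ q.2)
    (h : lkey (n + 1) p = lkey (n + 1) q) : p = q := by
  have h1 := h.le
  have h2 := h.ge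
  rw [lkey_le] at h1 h2
  have e1 : p.1 = q.1 := by omega
  have e2 : ladderIdx (n + 1) p = ladderIdx (n + 1) q := by omega
  rw [ladderIdx_eq, ladderIdx_eq, e1] at e2
  have := Nat.eq_of_mul_eq_mul_left (show 0 < n by omega) (Nat.add_left_cancel e2)
  exact Prod.ext e1 (by omega)

theorem finite_rem (ℓ i : ℕ) (μ : YPartition) : (RemovableRes ℓ i μ).Finite := by
  obtain ⟨N, hN⟩ := μ.eventually_zero
  refine ((Set.finite_lt_nat N).image fun a => (a, μ.part a)).subset ?_
  rintro ⟨a, b⟩ ⟨⟨h1, h2, h3⟩, _⟩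
  simp only at h1 h2 h3
  refine ⟨a, ?_, by rw [h2]⟩
  show a < N
  by_contra h
  have := hN a (by omega)
  omega

theorem finite_add (ℓ i : ℕ) (μ : YPartition) : (AddableRes ℓ i μ).Finite := by
  obtain ⟨N, hN⟩ := μ.eventually_zero
  refine ((Set.finite_lt_nat (N + 2)).image fun a => (a, μ.part a + 1)).subset ?_
  rintro ⟨a, b⟩ ⟨⟨h1, h2, h3⟩, _⟩
  simp only at h1 h2 h3
  refine ⟨a, ?_, by rw [h2]⟩
  show a < N + 2
  by_contra h
  have := hN (a - 1) (by omega)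
  omega

theorem finite_cells (μ : YPartition) : μ.cells.Finite := by
  obtain ⟨N, hN⟩ := μ.eventually_zero
  refine ((Set.finite_lt_nat N).prod (Set.finite_le_nat (μ.part 1))).subset ?_
  rintro ⟨a, b⟩ ⟨h1, h2, h3⟩
  simp only at h1 h2 h3
  have := μ.antitone 1 a le_rfl h1
  refine ⟨?_, by show b ≤ _; omega⟩
  show a < N
  by_contra h
  have := hN a (by omega)
  omega

/-- A removable box and a lower addable box never share a ladder. -/
theorem no_add_below (n : ℕ) (hn : 2 ≤ n) (μ : YPartition) (h : NoBad n μ) (p s : ℕ × ℕ)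
    (hp : Removable μ p) (hs : Addable μ s) (hps : p.1 < s.1)
    (hL : ladderIdx (n + 1) p = ladderIdx (n + 1) s) : False := by
  obtain ⟨x, y⟩ := p
  obtain ⟨x', y'⟩ := s
  obtain ⟨h1, h2, h3⟩ := hp
  obtain ⟨h4, h5, h6⟩ := hs
  simp only [ladderIdx_eq] at *
  have hy : y' < y := by
    by_contra hc
    have := Nat.mul_le_mul_left n (show y - 1 ≤ y' - 1 by omega)
    omega
  obtain ⟨m, rfl⟩ := Nat.exists_eq_add_of_le hy.le
  have : n * (y' + m - 1) = n * (y' - 1) + n * m := by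
    rw [← mul_add]; congr 1; omega
  have := h x y' m (x' - 1) h1 (by omega) (by omega) h2.symm (by omega) (by omega)
  rw [show x' - 1 + 1 = x' by omega] at this
  omega

/-- No addable box above a removable box, one `i`-ladder further. -/
theorem no_add_above (n : ℕ) (hn : 2 ≤ n) (μ : YPartition) (h : NoBad n μ) (q r : ℕ × ℕ)
    (hq : Removable μ q) (hr : Addable μ r) (hps : r.1 < q.1)
    (hL : ladderIdx (n + 1) r = ladderIdx (n + 1) q + (n + 1)) : False := by
  obtain ⟨x, y⟩ := r
  obtain ⟨x', y'⟩ := q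
  obtain ⟨h1, h2, h3⟩ := hq
  obtain ⟨h4, h5, h6⟩ := hr
  simp only [ladderIdx_eq] at *
  have hy : y' < y - 1 := by
    by_contra hc
    have := Nat.mul_le_mul_left n (show y - 1 ≤ (y' - 1) + 1 by omega)
    rw [mul_add] at this
    omega
  obtain ⟨m, hm⟩ := Nat.exists_eq_add_of_le hy.le
  have : n * (y - 1) = n * (y' - 1) + n + n * m := by
    rw [hm, show y' + m = (y' - 1) + 1 + m by omega]; ring
  have := h x y' m x' h4 (by omega) (by omega) (by omega) (by omega) (by omega)
  omega

/-- Remove a removable box. -/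
def remBox (μ : YPartition) (p : ℕ × ℕ) (hp : Removable μ p) : YPartition where
  part := fun x => if x = p.1 then μ.part x - 1 else μ.part x
  zero_at_zero := by
    have := hp.1
    have := μ.zero_at_zero
    split_ifs <;> omega
  antitone := by
    intro i j hi hij
    have h0 := μ.antitone i j hi hij
    obtain ⟨h1, h2, h3⟩ := hp
    split_ifs with c1 c2 c2
    · omega
    · omega
    · have := μ.antitone (p.1 + 1) j (by omega) (by omega)
      subst c2
      omega
    · exact h0
  eventually_zero := by
    obtain ⟨N, hN⟩ := μ.eventually_zero
    refine ⟨N, fun i hi => ?_⟩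
    have := hN i hi
    split_ifs <;> omega

theorem remBox_part (μ : YPartition) (p : ℕ × ℕ) (hp : Removable μ p) (x : ℕ) :
    (remBox μ p hp).part x = if x = p.1 then μ.part x - 1 else μ.part x := rfl

theorem remBox_cells (μ : YPartition) (p : ℕ × ℕ) (hp : Removable μ p) :
    μ.cells = insert p (remBox μ p hp).cells := by
  obtain ⟨a, b⟩ := p
  have h := hp
  obtain ⟨h1, h2, h3⟩ := h
  simp only at h1 h2 h3
  ext ⟨x, y⟩
  simp only [YPartition.cells, Set.mem_insert_iff, Set.mem_ofPred_eq, remBox_part, Prod.mk.injEq]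
  by_cases hx : x = a
  · subst hx
    simp only [if_true, true_and]
    omega
  · simp [hx]

theorem remBox_rem (n i : ℕ) (hn : 2 ≤ n) (μ : YPartition) (p : ℕ × ℕ) (hp : Removable μ p)
    (hi : res (n + 1) p = i) :
    RemovableRes (n + 1) i (remBox μ p hp) = RemovableRes (n + 1) i μ \ {p} := by
  subst hi
  obtain ⟨a, b⟩ := p
  have h := hp
  obtain ⟨h1, h2, h3⟩ := h
  simp only at h1 h2 h3
  ext ⟨x, y⟩
  simp only [RemovableRes, Removable, Set.mem_ofPred_eq, Set.mem_sdiff, Set.mem_singleton_iff,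
    remBox_part, Prod.mk.injEq]
  constructor
  · rintro ⟨⟨h4, h5, h6⟩, h7⟩
    by_cases hx : x = a
    · exfalso
      subst hx
      simp only [if_true] at h5
      exact res_ne_of_adj n hn (x, b) (x, y) (by simp only; omega) h7.symm
    · rw [if_neg hx] at h5
      by_cases hx2 : x + 1 = a
      · rw [if_pos hx2] at h6
        have hy : y ≠ b := by
          intro hy
          exact res_ne_of_adj n hn (x, y) (a, b) (by simp only; omega) h7
        subst hx2
        exact ⟨⟨⟨h4, h5, by omega⟩, h7⟩, by omega⟩
      · rw [if_neg hx2] at h6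
        exact ⟨⟨⟨h4, h5, h6⟩, h7⟩, by omega⟩
  · rintro ⟨⟨⟨h4, h5, h6⟩, h7⟩, h8⟩
    have hx : x ≠ a := by
      rintro rfl; omega
    refine ⟨⟨h4, by rw [if_neg hx]; exact h5, ?_⟩, h7⟩
    split_ifs <;> omega

theorem remBox_add (n i : ℕ) (hn : 2 ≤ n) (μ : YPartition) (p : ℕ × ℕ) (hp : Removable μ p)
    (hi : res (n + 1) p = i) :
    AddableRes (n + 1) i (remBox μ p hp) = insert p (AddableRes (n + 1) i μ) := by
  subst hi
  obtain ⟨a, b⟩ := p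
  have h := hp
  obtain ⟨h1, h2, h3⟩ := h
  simp only at h1 h2 h3
  ext ⟨x, y⟩
  simp only [AddableRes, Addable, Set.mem_ofPred_eq, Set.mem_insert_iff,
    remBox_part, Prod.mk.injEq]
  constructor
  · rintro ⟨⟨h4, h5, h6⟩, h7⟩
    by_cases hx : x = a
    · left
      subst hx
      simp only [if_true] at h5
      omega
    · right
      rw [if_neg hx] at h5
      refine ⟨⟨h4, h5, ?_⟩, h7⟩
      split_ifs at h6 <;> omega
  · rintro (⟨rfl, rfl⟩ | ⟨⟨h4, h5, h6⟩, h7⟩)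
    · refine ⟨⟨h1, by simp only [if_true]; omega, ?_⟩, rfl⟩
      by_cases hx : x = 1
      · exact Or.inl hx
      · right
        rw [if_neg (by omega)]
        have := μ.antitone (x - 1) x (by omega) (by omega)
        omega
    · have hx : x ≠ a := by
        rintro rfl
        exact res_ne_of_adj n hn (x, y) (x, b) (by simp only; omega) h7
      refine ⟨⟨h4, by rw [if_neg hx]; exact h5, ?_⟩, h7⟩
      by_cases hx1 : x = 1
      · exact Or.inl hx1
      · right
        have h6 : y ≤ μ.part (x - 1) := by omega
        by_cases hx2 : x - 1 = a
        · rw [if_pos hx2]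
          have hy : y ≠ b := by
            intro hy
            exact res_ne_of_adj n hn (a, b) (x, y) (by simp only; omega) h7.symm
          rw [hx2] at h6 ⊢
          omega
        · rw [if_neg hx2]; exact h6

/-- Removing a good box preserves `NoBad`. -/
theorem noBad_remBox (n i : ℕ) (hn : 2 ≤ n) (μ : YPartition) (h : NoBad n μ) (p : ℕ × ℕ)
    (hp : Removable μ p) (hg : LadderGood (n + 1) i μ p) : NoBad n (remBox μ p hp) := by
  intro a0 b0 m d ha hb hm hpa hd hbd
  by_contra hlt
  have hnm : n * 1 ≤ n * m := Nat.mul_le_mul_left n hm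
  obtain ⟨hnorm, hmin⟩ := hg
  have hpi : res (n + 1) p = i := hnorm.1.2
  have hp2 : 1 ≤ p.2 := by have := hp.2.2; omega
  unfold LadderNormal at hnorm hmin
  rw [ladderLE_eq] at hnorm hmin
  -- it suffices to produce an earlier removable box with no plus in between
  have suff : ∀ q, Removable μ q → res (n + 1) q = i → lkey (n + 1) q < lkey (n + 1) p →
      (∀ s, Addable μ s → res (n + 1) s = i → lkey (n + 1) q ≤ lkey (n + 1) s →
        lkey (n + 1) s ≤ lkey (n + 1) p → False) → False := by
    intro q hq hqi hqp hno
    have := normal_propagate (lkey (n + 1)) _ _ (finite_rem (n + 1) i μ) (finite_add (n + 1) i μ)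
      p q hnorm ⟨hq, hqi⟩ hqp (fun s hs => hno s hs.1 hs.2)
    exact absurd (hmin q this) (not_le.2 hqp)
  have hp' := hp
  obtain ⟨a, b⟩ := p
  obtain ⟨h1, h2, h3⟩ := hp'
  simp only [remBox_part] at *
  by_cases hc : a0 = a
  · subst hc
    rw [if_pos rfl] at hpa
    rw [if_neg (by omega)] at hbd hlt
    have hq1 : μ.part d = b0 := by
      by_contra hne
      have := h a0 (b0 + 1) m d ha (by omega) hm (by omega) hd (by omega)
      omega
    have hqR : Removable μ (d, b0) := ⟨by show 1 ≤ d; omega, hq1.symm, by show μ.part (d + 1) < b0; omega⟩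
    have hL : ladderIdx (n + 1) (a0, b) = ladderIdx (n + 1) (d, b0) + (n + 1) := by
      simp only [ladderIdx_eq]
      rw [show b - 1 = (b0 - 1) + 1 + m by omega, mul_add, mul_add]
      omega
    have hqi : res (n + 1) (d, b0) = i := by
      rw [← hpi, eq_comm, res_eq_iff n _ _ hp2 hb, hL]
      push_cast
      simp
    apply suff (d, b0) hqR hqi
    · rw [lkey_lt]; omega
    · intro s hs hsi h5 h6
      rw [lkey_le] at h5 h6
      have hs2 : 1 ≤ s.2 := by have := hs.2.1; omega
      have hdv := hsi.trans hqi.symm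
      rw [res_eq_iff n _ _ hs2 hb] at hdv
      by_cases e : ladderIdx (n + 1) s = ladderIdx (n + 1) (d, b0)
      · have hne : s.1 ≠ d := by
          intro hsd
          have e' := e
          have hs21 := hs.2.1
          rw [ladderIdx_eq, ladderIdx_eq, hsd] at e'
          rw [hsd] at hs21
          have := Nat.eq_of_mul_eq_mul_left (show 0 < n by omega) (Nat.add_left_cancel e')
          simp only at this
          omega
        exact no_add_below n hn μ h (d, b0) s hqR hs (by simp only at h5 ⊢; omega) e.symm
      · have hle := Int.le_of_dvd (by omega) hdv
        push_cast at hle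
        refine no_add_above n hn μ h (d, b0) s hqR hs ?_ (by omega)
        simp only at h6 ⊢
        omega
  · rw [if_neg hc] at hpa
    have hbd' : b0 ≤ μ.part d := by split_ifs at hbd <;> omega
    have hd1 := h a0 b0 m d ha hb hm hpa hd hbd'
    have hda : d + 1 = a := by
      by_contra hne
      rw [if_neg hne] at hlt
      omega
    rw [if_pos hda] at hlt
    subst hda
    have hbb : b = b0 := by omega
    subst hbb
    have hqR : Removable μ (a0, b + m) := by
      refine ⟨ha, hpa.symm, ?_⟩
      show μ.part (a0 + 1) < b + m
      by_contra hne
      have := μ.antitone a0 (a0 + 1) ha (by omega)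
      have := h (a0 + 1) b m (d + 1) (by omega) hb hm (by omega) (by omega) hd1
      omega
    have hL : ladderIdx (n + 1) (d + 1, b) = ladderIdx (n + 1) (a0, b + m) := by
      simp only [ladderIdx_eq]
      rw [show b + m - 1 = (b - 1) + m by omega, mul_add]
      omega
    have hqi : res (n + 1) (a0, b + m) = i := by
      rw [← hpi, eq_comm, res_eq_iff n _ _ hp2 (by show 1 ≤ b + m; omega), hL]
      simp
    apply suff (a0, b + m) hqR hqi
    · rw [lkey_lt]; simp only; omega
    · intro s hs hsi h5 h6
      rw [lkey_le] at h5 h6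
      have e : ladderIdx (n + 1) s = ladderIdx (n + 1) (a0, b + m) := by omega
      have hne : s.1 ≠ a0 := by
        intro hsd
        have e' := e
        have hs21 := hs.2.1
        rw [ladderIdx_eq, ladderIdx_eq, hsd] at e'
        rw [hsd] at hs21
        have := Nat.eq_of_mul_eq_mul_left (show 0 < n by omega) (Nat.add_left_cancel e')
        simp only at this
        omega
      exact no_add_below n hn μ h (a0, b + m) s hqR hs (by simp only at h5 ⊢; omega) e.symm

/-- A nonempty `NoBad` partition has a ladder good box. -/
theorem exists_good (n : ℕ) (hn : 2 ≤ n) (μ : YPartition) (h : NoBad n μ)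
    (hne : μ.cells.Nonempty) : ∃ i < n + 1, ∃ p, LadderGood (n + 1) i μ p := by
  obtain ⟨p, hp, hmax⟩ := Set.exists_max_image _ (ladderIdx (n + 1)) (finite_cells μ) hne
  have hpR : Removable μ p := by
    obtain ⟨a, b⟩ := p
    obtain ⟨h1, h2, h3⟩ := hp
    simp only at h1 h2 h3
    refine ⟨h1, ?_, ?_⟩
    · show b = μ.part a
      by_contra hc
      have := hmax (a, b + 1) ⟨h1, by show 1 ≤ b + 1; omega, by show b + 1 ≤ μ.part a; omega⟩
      simp only [ladderIdx_eq] at this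
      rw [show b + 1 - 1 = (b - 1) + 1 by omega, mul_add] at this
      omega
    · show μ.part (a + 1) < b
      by_contra hc
      have := hmax (a + 1, b) ⟨by show 1 ≤ a + 1; omega, h2, by show b ≤ μ.part (a + 1); omega⟩
      simp only [ladderIdx_eq] at this
      omega
  have hp2 : 1 ≤ p.2 := hp.2.1
  have hN : LadderNormal (n + 1) (res (n + 1) p) μ p := by
    unfold LadderNormal
    rw [ladderLE_eq]
    refine ⟨⟨hpR, rfl⟩, fun q hq hpq => ?_⟩
    have hem : AddableRes (n + 1) (res (n + 1) p) μ ∩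
        {s | lkey (n + 1) p ≤ lkey (n + 1) s ∧ lkey (n + 1) s ≤ lkey (n + 1) q} = ∅ := by
      ext s
      simp only [Set.mem_inter_iff, Set.mem_ofPred_eq, Set.mem_empty_iff_false, iff_false]
      rintro ⟨⟨hs, hsi⟩, h5, -⟩
      have hs2 : 1 ≤ s.2 := by have := hs.2.1; omega
      rw [res_eq_iff n _ _ hs2 hp2] at hsi
      rw [lkey_le] at h5
      by_cases e : ladderIdx (n + 1) p = ladderIdx (n + 1) s
      · have hne : s.1 ≠ p.1 := by
          intro hsd
          have e' := e
          have hs21 := hs.2.1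
          have hp21 := hpR.2.1
          rw [ladderIdx_eq, ladderIdx_eq, hsd] at e'
          rw [hsd] at hs21
          have := Nat.eq_of_mul_eq_mul_left (show 0 < n by omega) (Nat.add_left_cancel e')
          omega
        exact no_add_below n hn μ h p s hpR hs (by omega) e
      · have hle := Int.le_of_dvd (by omega) hsi
        push_cast at hle
        obtain ⟨x, y⟩ := s
        obtain ⟨h6, h7, h8⟩ := hs
        simp only [ladderIdx_eq] at *
        by_cases hy : y = 1
        · have hx : x ≠ 1 := by
            rintro rfl
            subst hy
            simp only [Nat.sub_self, mul_zero] at hle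
            have := hp.1
            push_cast at hle
            have : 0 ≤ (n : ℤ) * ((p.2 - 1 : ℕ) : ℤ) := by positivity
            omega
          have := hmax (x - 1, y) ⟨by show 1 ≤ x - 1; omega, hs2, by show y ≤ μ.part (x - 1); omega⟩
          simp only at this
          zify at this hle
          omega
        · have := hmax (x, y - 1) ⟨h6, by show 1 ≤ y - 1; omega, by show y - 1 ≤ μ.part x; omega⟩
          simp only at this
          have e3 : n * (y - 1) = n * (y - 1 - 1) + n := by
            conv_lhs => rw [show y - 1 = (y - 1 - 1) + 1 by omega, mul_add, mul_one]
          omega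
    show (AddableRes (n + 1) (res (n + 1) p) μ ∩
        {s | lkey (n + 1) p ≤ lkey (n + 1) s ∧ lkey (n + 1) s ≤ lkey (n + 1) q}).ncard < _
    rw [hem, Set.ncard_empty, Set.ncard_pos ((finite_rem _ _ _).subset Set.inter_subset_left)]
    exact ⟨p, ⟨hpR, rfl⟩, le_rfl, hpq⟩
  refine ⟨res (n + 1) p, ?_, ?_⟩
  · unfold res
    have := Int.emod_lt_of_pos ((p.2 : ℤ) - p.1) (show (0 : ℤ) < ((n + 1 : ℕ) : ℤ) by omega)
    omega
  · have hfin : {q | LadderNormal (n + 1) (res (n + 1) p) μ q}.Finite :=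
      (finite_rem _ _ _).subset fun q hq => hq.1
    obtain ⟨g, hg, hgm⟩ := Set.exists_min_image _ (lkey (n + 1)) hfin ⟨p, hN⟩
    refine ⟨g, hg, fun q hq => ?_⟩
    rw [ladderLE_eq]
    exact hgm q hq

theorem ext_part (μ ν : YPartition) (h : ∀ x, μ.part x = ν.part x) : μ = ν := by
  cases μ; cases ν
  congr
  exact funext h

theorem node_of_noBad (n : ℕ) (hn : 2 ≤ n) (k : ℕ) : ∀ μ : YPartition, μ.cells.ncard = k →
    NoBad n μ → LadderNode (n + 1) μ := by
  induction k with
  | zero =>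
    intro μ hk _
    rw [Set.ncard_eq_zero (finite_cells μ)] at hk
    have : μ = emptyP := by
      apply ext_part
      intro x
      show μ.part x = 0
      by_contra hx
      have hx0 : x ≠ 0 := by
        rintro rfl; exact hx μ.zero_at_zero
      have : (x, 1) ∈ μ.cells := ⟨by show 1 ≤ x; omega, le_rfl, by show 1 ≤ μ.part x; omega⟩
      rw [hk] at this
      exact this
    rw [this]
    exact Relation.ReflTransGen.refl
  | succ k ih =>
    intro μ hk hB
    have hne : μ.cells.Nonempty := by
      rw [← Set.ncard_pos (finite_cells μ)]; omega
    obtain ⟨i, hi, p, hg⟩ := exists_good n hn μ hB hne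
    have hp : Removable μ p := hg.1.1.1
    have hpi : res (n + 1) p = i := hg.1.1.2
    have hcells := remBox_cells μ p hp
    have hpn : p ∉ (remBox μ p hp).cells := by
      rintro ⟨h1, h2, h3⟩
      rw [remBox_part, if_pos rfl] at h3
      have := hp.2.1
      omega
    have hcard : (remBox μ p hp).cells.ncard = k := by
      rw [hcells, Set.ncard_insert_of_notMem hpn (finite_cells _)] at hk
      omega
    refine Relation.ReflTransGen.tail (ih _ hcard (noBad_remBox n i hn μ hB p hp hg)) ?_
    refine ⟨i, hi, p, ?_, hcells⟩
    unfold LadderCogood LadderConormal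
    unfold LadderGood LadderNormal at hg
    rw [ladderLE_eq] at hg ⊢
    have hR := finite_rem (n + 1) i μ
    have hA := finite_add (n + 1) i μ
    have c2 : ∀ x ∈ hR.toFinset ∪ hA.toFinset, 1 ≤ x.2 := by
      intro x hx
      rw [Finset.mem_union, Set.Finite.mem_toFinset, Set.Finite.mem_toFinset] at hx
      rcases hx with hx | hx
      · have := hx.1.2.2; omega
      · have := hx.1.2.1; omega
    apply good_cogood (lkey (n + 1)) hR.toFinset hA.toFinset
    · intro x hx y hy hxy
      exact lkey_inj n hn x y (c2 x hx) (c2 y hy) hxy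
    · rw [Finset.disjoint_left]
      intro x hx hx'
      rw [Set.Finite.mem_toFinset] at hx hx'
      have := hx.1.2.1
      have := hx'.1.2.1
      omega
    · rw [hR.coe_toFinset, hA.coe_toFinset]; exact hg.1
    · rw [hR.coe_toFinset, hA.coe_toFinset]; exact hg.2
    · rw [hR.coe_toFinset]; exact remBox_rem n i hn μ p hp hpi
    · rw [hA.coe_toFinset]; exact remBox_add n i hn μ p hp hpi

/-- every `(ℓ,0)`-JM partition is a node of the ladder crystal `B(Λ₀)^L`. -/
theorem statement15 (ℓ : ℕ) (hℓ : 2 < ℓ) (lam : YPartition) (hJM : IsJM ℓ lam) :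
    LadderNode ℓ lam := by
  obtain ⟨n, rfl⟩ : ∃ n, ℓ = n + 1 := ⟨ℓ - 1, by omega⟩
  exact node_of_noBad n (by omega) _ lam rfl (noBad_of_JM n (by omega) lam hJM)
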